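/- arXiv:2410.23146 — 3 statements merged into one kernel-verified Lean document; each statement's English description precedes it below -/
import Mathlib

section
/- Suppose we observe K distinct pairs of marginals (μ^(k),ν^(k)) ∈ Δ_N × Δ_M, values α^(k) ∈ ℝ, and pairs (f^(k),g^(k)) ∈ ℝ^N × ℝ^M with ⟨f^(k),μ^(k)⟩ + ⟨g^(k),ν^(k)⟩ = α^(k). Call c' ∈ ℝ^{N×M} consistent if for all k: (f^(k),g^(k)) ∈ Φ_{c'} and OT_{c'}(μ^(k),ν^(k)) = α^(k). Assume at least one consistent matrix exists. Then there is exactly one consistent matrix if and only if there exists c₀ ∈ ℝ^{N×M} such that for every choice of extreme points u^(k) ∈ EP(μ^(k),ν^(k)), k = 1,…,K, the solution set of the system { ⟨c', v⟩ ≥ α^(k) for all v ∈ EP(μ^(k),ν^(k)) \ {u^(k)}, ⟨c', u^(k)⟩ = α^(k), c'_{i,j} ≥ f^(k)_i + g^(k)_j for all (i,j) with equality whenever u^(k)_{i,j} > 0, for all k } is either empty or equal to {c₀}. -/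
open Finset

noncomputable section

/-- Frobenius inner product of two `N × M` real matrices. -/
def frob {N M : ℕ} (c π : Matrix (Fin N) (Fin M) ℝ) : ℝ := ∑ i, ∑ j, c i j * π i j

/-- The set `Π(μ,ν)` of transport plans between `μ` and `ν`. -/
def Plans {N M : ℕ} (μ : Fin N → ℝ) (ν : Fin M → ℝ) : Set (Matrix (Fin N) (Fin M) ℝ) :=
  {π | (∀ i j, 0 ≤ π i j) ∧ (∀ i, ∑ j, π i j = μ i) ∧ (∀ j, ∑ i, π i j = ν j)}

/-- The optimal transport cost `OT_c(μ,ν)`. -/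
def OTcost {N M : ℕ} (c : Matrix (Fin N) (Fin M) ℝ) (μ : Fin N → ℝ) (ν : Fin M → ℝ) : ℝ :=
  sInf (frob c '' Plans μ ν)

/-- The set `EP(μ,ν)` of extreme points of the transport polytope. -/
def EP {N M : ℕ} (μ : Fin N → ℝ) (ν : Fin M → ℝ) : Set (Matrix (Fin N) (Fin M) ℝ) :=
  Set.extremePoints ℝ (Plans μ ν)

theorem isCompact_Plans {N M : ℕ} (μ : Fin N → ℝ) (ν : Fin M → ℝ) : IsCompact (Plans μ ν) := by
  have hbox : IsCompact (Set.univ.pi fun i : Fin N => Set.univ.pi fun _ : Fin M =>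
      Set.Icc (0 : ℝ) (μ i)) :=
    isCompact_univ_pi fun i => isCompact_univ_pi fun _ => isCompact_Icc
  refine IsCompact.of_isClosed_subset hbox ?_ ?_
  · have hrow : ∀ i j, Continuous fun π : Matrix (Fin N) (Fin M) ℝ => π i j :=
      fun i j => continuous_id.matrix_elem i j
    have h : Plans μ ν = (⋂ i, ⋂ j, {π : Matrix (Fin N) (Fin M) ℝ | 0 ≤ π i j}) ∩
        ((⋂ i, {π : Matrix (Fin N) (Fin M) ℝ | ∑ j, π i j = μ i}) ∩
          ⋂ j, {π : Matrix (Fin N) (Fin M) ℝ | ∑ i, π i j = ν j}) := by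
      ext π
      simp [Plans]
    rw [h]
    refine (isClosed_iInter fun i => isClosed_iInter fun j =>
      isClosed_le continuous_const (hrow i j)).inter
      ((isClosed_iInter fun i => isClosed_eq
        (continuous_finsetSum _ fun j _ => hrow i j) continuous_const).inter
      (isClosed_iInter fun j => isClosed_eq
        (continuous_finsetSum _ fun i _ => hrow i j) continuous_const))
  · intro π hπ i _ j _
    refine ⟨hπ.1 i j, ?_⟩
    rw [← hπ.2.1 i]
    exact single_le_sum (f := fun j => π i j) (fun j _ => hπ.1 i j) (mem_univ j)

theorem Plans_nonempty {N M : ℕ} {μ : Fin N → ℝ} {ν : Fin M → ℝ}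
    (hμ : μ ∈ stdSimplex ℝ (Fin N)) (hν : ν ∈ stdSimplex ℝ (Fin M)) : (Plans μ ν).Nonempty := by
  refine ⟨fun i j => μ i * ν j, fun i j => mul_nonneg (hμ.1 i) (hν.1 j), fun i => ?_, fun j => ?_⟩
  · rw [← mul_sum, hν.2, mul_one]
  · rw [← sum_mul, hμ.2, one_mul]

/-- The Frobenius product with a fixed matrix, as a continuous linear functional. -/
def frobCLM {N M : ℕ} (c : Matrix (Fin N) (Fin M) ℝ) : (Fin N → Fin M → ℝ) →L[ℝ] ℝ where
  toFun := fun π => frob c π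
  map_add' x y := by simp [frob, mul_add, sum_add_distrib]
  map_smul' r x := by simp [frob, mul_sum, mul_left_comm]
  cont := by
    unfold frob
    fun_prop

/-- A linear cost attains its minimum over the transport polytope at an extreme point. -/
theorem exists_EP_frob_eq_OTcost {N M : ℕ} (c : Matrix (Fin N) (Fin M) ℝ)
    {μ : Fin N → ℝ} {ν : Fin M → ℝ}
    (hμ : μ ∈ stdSimplex ℝ (Fin N)) (hν : ν ∈ stdSimplex ℝ (Fin M)) :
    ∃ u ∈ EP μ ν, frob c u = OTcost c μ ν := by
  let P : Set (Fin N → Fin M → ℝ) := Plans μ ν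
  have hP : IsCompact P := isCompact_Plans μ ν
  obtain ⟨p, hp, hmin⟩ := hP.exists_isMinOn (Plans_nonempty hμ hν) (frobCLM c).continuous.continuousOn
  have hF : IsExposed ℝ P ((-frobCLM c).toExposed P) :=
    ContinuousLinearMap.toExposed.isExposed
  have hpF : p ∈ (-frobCLM c).toExposed P := ⟨hp, fun y hy => neg_le_neg (hmin hy)⟩
  obtain ⟨u, hu⟩ := (hF.isCompact hP).extremePoints_nonempty ⟨p, hpF⟩
  refine ⟨u, hF.isExtreme.extremePoints_subset_extremePoints hu, ?_⟩
  have huF := extremePoints_subset hu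
  have hle : IsLeast (frob c '' Plans μ ν) (frob c u) := by
    refine ⟨⟨u, huF.1, rfl⟩, ?_⟩
    rintro _ ⟨y, hy, rfl⟩
    exact neg_le_neg_iff.mp (huF.2 y hy)
  exact hle.csInf_eq.symm

theorem frob_potentials {N M : ℕ} {μ : Fin N → ℝ} {ν : Fin M → ℝ} (f : Fin N → ℝ) (g : Fin M → ℝ)
    {π : Matrix (Fin N) (Fin M) ℝ} (hπ : π ∈ Plans μ ν) :
    ∑ i, ∑ j, (f i + g j) * π i j = ∑ i, f i * μ i + ∑ j, g j * ν j := by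
  simp only [add_mul, sum_add_distrib, ← hπ.2.1, ← hπ.2.2, mul_sum]
  rw [sum_comm (f := fun i j => g j * π i j)]

/-- Weak duality. -/
theorem potentials_le_frob {N M : ℕ} {c : Matrix (Fin N) (Fin M) ℝ} {μ : Fin N → ℝ}
    {ν : Fin M → ℝ} {f : Fin N → ℝ} {g : Fin M → ℝ} (hc : ∀ i j, f i + g j ≤ c i j)
    {π : Matrix (Fin N) (Fin M) ℝ} (hπ : π ∈ Plans μ ν) :
    ∑ i, f i * μ i + ∑ j, g j * ν j ≤ frob c π := by
  rw [← frob_potentials f g hπ]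
  exact sum_le_sum fun i _ => sum_le_sum fun j _ => mul_le_mul_of_nonneg_right (hc i j) (hπ.1 i j)

/-- Complementary slackness. -/
theorem eq_potentials_of_frob_eq {N M : ℕ} {c : Matrix (Fin N) (Fin M) ℝ} {μ : Fin N → ℝ}
    {ν : Fin M → ℝ} {f : Fin N → ℝ} {g : Fin M → ℝ} (hc : ∀ i j, f i + g j ≤ c i j)
    {π : Matrix (Fin N) (Fin M) ℝ} (hπ : π ∈ Plans μ ν)
    (h : frob c π = ∑ i, f i * μ i + ∑ j, g j * ν j) {i : Fin N} {j : Fin M} (hij : 0 < π i j) :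
    c i j = f i + g j := by
  have hle : ∀ i j, (f i + g j) * π i j ≤ c i j * π i j :=
    fun i j => mul_le_mul_of_nonneg_right (hc i j) (hπ.1 i j)
  rw [← frob_potentials f g hπ, frob, eq_comm,
    sum_eq_sum_iff_of_le fun i _ => sum_le_sum fun j _ => hle i j] at h
  have hi := (sum_eq_sum_iff_of_le fun j _ => hle i j).mp (h i (mem_univ i)) j (mem_univ j)
  exact (mul_right_cancel₀ hij.ne' hi).symm

theorem OTcost_eq_of_frob_eq {N M : ℕ} {c : Matrix (Fin N) (Fin M) ℝ} {μ : Fin N → ℝ}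
    {ν : Fin M → ℝ} {f : Fin N → ℝ} {g : Fin M → ℝ} (hc : ∀ i j, f i + g j ≤ c i j)
    {π : Matrix (Fin N) (Fin M) ℝ} (hπ : π ∈ Plans μ ν)
    (h : frob c π = ∑ i, f i * μ i + ∑ j, g j * ν j) :
    OTcost c μ ν = ∑ i, f i * μ i + ∑ j, g j * ν j := by
  have hleast : IsLeast (frob c '' Plans μ ν) (∑ i, f i * μ i + ∑ j, g j * ν j) := by
    refine ⟨⟨π, hπ, h⟩, ?_⟩
    rintro _ ⟨y, hy, rfl⟩
    exact potentials_le_frob hc hy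
  exact hleast.csInf_eq

/-- Identifiability from total costs and optimal potentials: assuming a consistent cost matrix
exists, it is unique iff for every choice of extreme points the corresponding system is
inconsistent or has a unique solution independent of the choice. -/
theorem stmt5 (N M K : ℕ) (hN : 1 ≤ N) (hM : 1 ≤ M)
    (μ : Fin K → Fin N → ℝ) (ν : Fin K → Fin M → ℝ)
    (hμ : ∀ k, μ k ∈ stdSimplex ℝ (Fin N)) (hν : ∀ k, ν k ∈ stdSimplex ℝ (Fin M))
    (hdist : Function.Injective (fun k => (μ k, ν k)))
    (α : Fin K → ℝ) (f : Fin K → Fin N → ℝ) (g : Fin K → Fin M → ℝ)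
    (hα : ∀ k, (∑ i, f k i * μ k i) + (∑ j, g k j * ν k j) = α k)
    (hex : ∃ c : Matrix (Fin N) (Fin M) ℝ,
      ∀ k, (∀ i j, f k i + g k j ≤ c i j) ∧ OTcost c (μ k) (ν k) = α k) :
    (∃! c' : Matrix (Fin N) (Fin M) ℝ,
        ∀ k, (∀ i j, f k i + g k j ≤ c' i j) ∧ OTcost c' (μ k) (ν k) = α k) ↔
      ∃ c₀ : Matrix (Fin N) (Fin M) ℝ,
        ∀ u : (k : Fin K) → Matrix (Fin N) (Fin M) ℝ, (∀ k, u k ∈ EP (μ k) (ν k)) →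
          ({c' : Matrix (Fin N) (Fin M) ℝ | ∀ k,
              (∀ v ∈ EP (μ k) (ν k) \ {u k}, α k ≤ frob c' v) ∧
              frob c' (u k) = α k ∧
              (∀ i j, f k i + g k j ≤ c' i j) ∧
              (∀ i j, 0 < u k i j → c' i j = f k i + g k j)} = ∅ ∨
           {c' : Matrix (Fin N) (Fin M) ℝ | ∀ k,
              (∀ v ∈ EP (μ k) (ν k) \ {u k}, α k ≤ frob c' v) ∧
              frob c' (u k) = α k ∧
              (∀ i j, f k i + g k j ≤ c' i j) ∧
              (∀ i j, 0 < u k i j → c' i j = f k i + g k j)} = {c₀}) := by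
  constructor
  · rintro ⟨c₀, -, huniq⟩
    refine ⟨c₀, fun u hu => Set.subset_singleton_iff_eq.mp fun c hc => huniq c fun k => ?_⟩
    obtain ⟨-, hval, hpot, -⟩ := hc k
    refine ⟨hpot, ?_⟩
    rw [← hα k] at hval ⊢
    exact OTcost_eq_of_frob_eq hpot (extremePoints_subset (hu k)) hval
  · rintro ⟨c₀, h₀⟩
    have key : ∀ c : Matrix (Fin N) (Fin M) ℝ,
        (∀ k, (∀ i j, f k i + g k j ≤ c i j) ∧ OTcost c (μ k) (ν k) = α k) → c = c₀ := by
      intro c hc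
      choose u hu hval using fun k => exists_EP_frob_eq_OTcost c (hμ k) (hν k)
      have hval' : ∀ k, frob c (u k) = α k := fun k => (hval k).trans (hc k).2
      have hsub := Set.subset_singleton_iff_eq.mpr (h₀ u hu)
      refine hsub fun k => ⟨fun v hv => ?_, hval' k, (hc k).1, fun i j hij => ?_⟩
      · rw [← hα k]
        exact potentials_le_frob (hc k).1 (extremePoints_subset hv.1)
      · exact eq_potentials_of_frob_eq (hc k).1 (extremePoints_subset (hu k))
          ((hval' k).trans (hα k).symm) hij
    obtain ⟨c, hc⟩ := hex
    exact ⟨c, hc, fun c' hc' => (key c' hc').trans (key c hc).symm⟩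
end
end

section
/- Let c ∈ ℝ^{N×M} and suppose that for k = 1,…,K we have distinct pairs of marginals (μ^(k),ν^(k)) ∈ Δ_N × Δ_M, optimal plans π^(k) ∈ OPT_c(μ^(k),ν^(k)), and extreme points u^(1,k),…,u^(L_k,k) ∈ EP(μ^(k),ν^(k)) representing π^(k) such that the convex hull of {u^(ℓ,k) : ℓ ∈ {1,…,L_k}} equals OPT_c(μ^(k),ν^(k)) for every k. If dim span{π^(k) − u^(ℓ,k) : ℓ ∈ {1,…,L_k}, k ∈ {1,…,K}} < (N−1)(M−1) − S for some S ∈ ℕ₀, then for every choice of S matrices w_1,…,w_S ∈ ℝ^{N×M} there exists c' ∈ ℝ^{N×M} with π^(k) ∈ OPT_{c'}(μ^(k),ν^(k)) for all k and c' − c ∉ {a ⊕ b : a ∈ ℝ^N, b ∈ ℝ^M} + span{w_1,…,w_S}. -/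
open Finset

noncomputable section

/-- The set `OPT_c(μ,ν)` of optimal transport plans. -/
def OPT {N M : ℕ} (c : Matrix (Fin N) (Fin M) ℝ) (μ : Fin N → ℝ) (ν : Fin M → ℝ) :
    Set (Matrix (Fin N) (Fin M) ℝ) :=
  {π ∈ Plans μ ν | frob c π = OTcost c μ ν}

/-- The outer sum `f ⊕ g = [f_i + g_j]_{i,j}`. -/
def oplus {N M : ℕ} (f : Fin N → ℝ) (g : Fin M → ℝ) : Matrix (Fin N) (Fin M) ℝ :=
  fun i j => f i + g j

section TransportPolytope

variable {N M : ℕ}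

/-- The Frobenius inner product as a bilinear map. -/
def frobBilin : Matrix (Fin N) (Fin M) ℝ →ₗ[ℝ] Matrix (Fin N) (Fin M) ℝ →ₗ[ℝ] ℝ :=
  LinearMap.mk₂ ℝ frob
    (fun x y z => by simp [frob, add_mul, Finset.sum_add_distrib])
    (fun r x y => by simp [frob, Finset.mul_sum, mul_assoc])
    (fun x y z => by simp [frob, mul_add, Finset.sum_add_distrib])
    (fun r x y => by simp [frob, Finset.mul_sum, mul_left_comm])

lemma frobBilin_apply (x y : Matrix (Fin N) (Fin M) ℝ) : frobBilin x y = frob x y := rfl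

lemma frob_add_smul_left (c h x : Matrix (Fin N) (Fin M) ℝ) (t : ℝ) :
    frob (c + t • h) x = frob c x + t * frob h x := by
  simp [← frobBilin_apply]

lemma continuous_frob (c : Matrix (Fin N) (Fin M) ℝ) : Continuous (frob c) := by
  unfold frob
  fun_prop

lemma convex_plans (μ : Fin N → ℝ) (ν : Fin M → ℝ) : Convex ℝ (Plans μ ν) := by
  rintro x ⟨hx, hxr, hxc⟩ y ⟨hy, hyr, hyc⟩ a b ha hb hab
  refine ⟨fun i j => ?_, fun i => ?_, fun j => ?_⟩
  · exact add_nonneg (mul_nonneg ha (hx i j)) (mul_nonneg hb (hy i j))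
  · simp [Finset.sum_add_distrib, ← Finset.mul_sum, hxr, hyr, ← add_mul, hab]
  · simp [Finset.sum_add_distrib, ← Finset.mul_sum, hxc, hyc, ← add_mul, hab]

lemma isCompact_plans (μ : Fin N → ℝ) (ν : Fin M → ℝ) : IsCompact (Plans μ ν) := by
  have hbox : IsCompact (Set.univ.pi fun i : Fin N => Set.univ.pi fun _ : Fin M =>
      Set.Icc (0 : ℝ) (μ i)) :=
    isCompact_univ_pi fun i => isCompact_univ_pi fun _ => isCompact_Icc
  refine hbox.of_isClosed_subset ?_ ?_
  · have : Plans μ ν = (⋂ i, ⋂ j, {π | 0 ≤ π i j}) ∩ ((⋂ i, {π | ∑ j, π i j = μ i}) ∩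
        ⋂ j, {π | ∑ i, π i j = ν j}) := by
      ext x
      simp [Plans]
    rw [this]
    refine (isClosed_iInter fun i => isClosed_iInter fun j => ?_).inter
      ((isClosed_iInter fun i => ?_).inter (isClosed_iInter fun j => ?_))
    · exact isClosed_le (by fun_prop) (by fun_prop)
    · exact isClosed_eq (by fun_prop) (by fun_prop)
    · exact isClosed_eq (by fun_prop) (by fun_prop)
  · rintro x ⟨hx, hxr, -⟩ i - j -
    refine ⟨hx i j, ?_⟩
    rw [← hxr i]
    exact Finset.single_le_sum (f := fun j => x i j) (fun j _ => hx i j) (Finset.mem_univ j)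

lemma mem_OPT_iff {c π : Matrix (Fin N) (Fin M) ℝ} {μ : Fin N → ℝ} {ν : Fin M → ℝ} :
    π ∈ OPT c μ ν ↔ π ∈ Plans μ ν ∧ ∀ x ∈ Plans μ ν, frob c π ≤ frob c x := by
  refine and_congr_right fun hπ => ⟨fun h x hx => ?_, fun h => ?_⟩
  · rw [h]
    exact csInf_le ((isCompact_plans μ ν).image (continuous_frob c)).bddBelow ⟨x, hx, rfl⟩
  · have hmem : frob c π ∈ frob c '' Plans μ ν := ⟨π, hπ, rfl⟩
    refine (IsLeast.csInf_eq ⟨hmem, ?_⟩).symm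
    rintro _ ⟨x, hx, rfl⟩
    exact h x hx

/-- An extreme point of the transport polytope is determined by its support. -/
lemma eq_of_mem_EP_of_support_eq {μ : Fin N → ℝ} {ν : Fin M → ℝ}
    {x y : Matrix (Fin N) (Fin M) ℝ} (hx : x ∈ EP μ ν) (hy : y ∈ Plans μ ν)
    (hsupp : ∀ i j, x i j = 0 → y i j = 0) : x = y := by
  obtain ⟨hxP, hext⟩ := hx
  have hsmall : ∀ᶠ t in nhdsWithin (0 : ℝ) (Set.Ioi 0),
      ∀ i j, 0 ≤ x i j + t * (x i j - y i j) := by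
    refine Filter.eventually_all.2 fun i => Filter.eventually_all.2 fun j => ?_
    rcases (hxP.1 i j).eq_or_lt with h0 | hpos
    · exact Filter.Eventually.of_forall fun t => by simp [← h0, hsupp i j h0.symm]
    · have hlim : Filter.Tendsto (fun t : ℝ => x i j + t * (x i j - y i j))
          (nhdsWithin 0 (Set.Ioi 0)) (nhds (x i j + 0 * (x i j - y i j))) :=
        Filter.Tendsto.mono_left
          (Continuous.tendsto (by fun_prop) 0) nhdsWithin_le_nhds
      rw [zero_mul, add_zero] at hlim
      exact (hlim.eventually (lt_mem_nhds hpos)).mono fun t ht => ht.le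
  obtain ⟨t, ht, htpos⟩ := (hsmall.and self_mem_nhdsWithin).exists
  replace htpos : 0 < t := htpos
  have hz : x + t • (x - y) ∈ Plans μ ν := by
    refine ⟨fun i j => by simpa using ht i j, fun i => ?_, fun j => ?_⟩
    · simp [Finset.sum_add_distrib, ← Finset.mul_sum, hxP.2.1, hy.2.1]
    · simp [Finset.sum_add_distrib, ← Finset.mul_sum, hxP.2.2, hy.2.2]
  refine (hext hy hz ⟨t / (1 + t), 1 / (1 + t), by positivity, by positivity, ?_, ?_⟩).symm
  · field_simp
    ring
  · ext i j
    simp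
    field_simp
    ring

lemma finite_EP (μ : Fin N → ℝ) (ν : Fin M → ℝ) : (EP μ ν).Finite := by
  refine Set.Finite.of_finite_image
    (f := fun x => {p : Fin N × Fin M | x p.1 p.2 = 0}) (Set.toFinite _) ?_
  intro x hx y hy hxy
  refine eq_of_mem_EP_of_support_eq hx hy.1 fun i j h => ?_
  exact (Set.ext_iff.1 hxy (i, j)).1 h

/-- A linear cost is bounded below on the transport polytope by any lower bound on its extreme
points. -/
lemma le_frob_of_forall_EP {c : Matrix (Fin N) (Fin M) ℝ} {μ : Fin N → ℝ} {ν : Fin M → ℝ} {r : ℝ}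
    (h : ∀ v ∈ EP μ ν, r ≤ frob c v) {x : Matrix (Fin N) (Fin M) ℝ} (hx : x ∈ Plans μ ν) :
    r ≤ frob c x := by
  have hKM : closure (convexHull ℝ (EP μ ν)) = Plans μ ν :=
    closure_convexHull_extremePoints (E := Fin N → Fin M → ℝ)
      (isCompact_plans μ ν) (convex_plans μ ν)
  rw [← hKM] at hx
  have hconv : Convex ℝ {x | r ≤ frob c x} :=
    convex_halfSpace_ge (frobBilin c).isLinear r
  exact closure_minimal (convexHull_min h hconv)
    (isClosed_le continuous_const (continuous_frob c)) hx

/-- The outer sum as a linear map. -/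
def oplusLin (N M : ℕ) : (Fin N → ℝ) × (Fin M → ℝ) →ₗ[ℝ] Matrix (Fin N) (Fin M) ℝ where
  toFun p := oplus p.1 p.2
  map_add' p q := by
    ext i j
    simp [oplus]
    ring
  map_smul' r p := by
    ext i j
    simp [oplus]
    ring

lemma finrank_span_oplus_lt (hN : 1 ≤ N) :
    Module.finrank ℝ
      (Submodule.span ℝ {x : Matrix (Fin N) (Fin M) ℝ | ∃ a b, x = oplus a b}) < N + M := by
  have hrange : Submodule.span ℝ {x : Matrix (Fin N) (Fin M) ℝ | ∃ a b, x = oplus a b} =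
      LinearMap.range (oplusLin N M) := by
    rw [← Submodule.span_eq (LinearMap.range (oplusLin N M))]
    congr 1
    ext x
    simp [oplusLin, eq_comm]
  have hker : 0 < Module.finrank ℝ (LinearMap.ker (oplusLin N M)) := by
    refine Module.finrank_pos_iff_exists_ne_zero.2
      ⟨⟨(fun _ => 1, fun _ => -1), ?_⟩, fun h => ?_⟩
    · ext i j
      simp [oplusLin, oplus]
    · have := congrFun (congrArg (fun p => p.1.1) h) ⟨0, hN⟩
      simp at this
  have hsum := LinearMap.finrank_range_add_finrank_ker (oplusLin N M)
  simp only [Module.finrank_prod, Module.finrank_fintype_fun_eq_card, Fintype.card_fin] at hsum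
  rw [hrange]
  omega

/-- A subspace `Z` too small to contain the Frobenius-orthogonal complement of `D` misses one of
its elements. -/
lemma exists_frob_eq_zero_notMem (D Z : Submodule ℝ (Matrix (Fin N) (Fin M) ℝ))
    (hdim : Module.finrank ℝ D + Module.finrank ℝ Z < N * M) :
    ∃ h, (∀ d ∈ D, frob h d = 0) ∧ h ∉ Z := by
  let restrict : Matrix (Fin N) (Fin M) ℝ →ₗ[ℝ] Module.Dual ℝ D :=
    D.subtype.dualMap ∘ₗ frobBilin
  have hnot : ¬ LinearMap.ker restrict ≤ Z := fun hle => by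
    have hker := Submodule.finrank_mono hle
    have hrange := Submodule.finrank_le (LinearMap.range restrict)
    have hsum := LinearMap.finrank_range_add_finrank_ker restrict
    rw [Subspace.dual_finrank_eq] at hrange
    simp only [Module.finrank_matrix, Fintype.card_fin, Module.finrank_self, mul_one] at hsum
    omega
  obtain ⟨h, hh, hZ⟩ := SetLike.not_le_iff_exists.1 hnot
  exact ⟨h, fun d hd => LinearMap.congr_fun (LinearMap.mem_ker.1 hh) ⟨d, hd⟩, hZ⟩

/-- If a perturbation direction is constant on the optimal face, then optimality persists under
small perturbations of the cost. -/
lemma eventually_mem_OPT {c h π : Matrix (Fin N) (Fin M) ℝ} {μ : Fin N → ℝ} {ν : Fin M → ℝ}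
    (hπ : π ∈ OPT c μ ν) (hface : ∀ v ∈ OPT c μ ν, frob h v = frob h π) :
    ∀ᶠ t in nhdsWithin (0 : ℝ) (Set.Ioi 0), π ∈ OPT (c + t • h) μ ν := by
  obtain ⟨hπP, hmin⟩ := mem_OPT_iff.1 hπ
  have hEP : ∀ᶠ t in nhdsWithin (0 : ℝ) (Set.Ioi 0),
      ∀ v ∈ EP μ ν, frob (c + t • h) π ≤ frob (c + t • h) v := by
    refine (Filter.eventually_all_finite (finite_EP μ ν)).2 fun v hv => ?_
    simp only [frob_add_smul_left]
    rcases (hmin v hv.1).eq_or_lt with heq | hlt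
    · have hvO : v ∈ OPT c μ ν := ⟨hv.1, heq ▸ hπ.2⟩
      exact Filter.Eventually.of_forall fun t => by rw [heq, hface v hvO]
    · have hlim (x : Matrix (Fin N) (Fin M) ℝ) :
          Filter.Tendsto (fun t : ℝ => frob c x + t * frob h x)
            (nhdsWithin 0 (Set.Ioi 0)) (nhds (frob c x)) := by
        have : Continuous fun t : ℝ => frob c x + t * frob h x := by fun_prop
        simpa using (this.tendsto 0).mono_left nhdsWithin_le_nhds
      exact ((hlim π).eventually_lt (hlim v) hlt).mono fun t ht => ht.le
  exact hEP.mono fun t ht => mem_OPT_iff.2 ⟨hπP, fun x hx => le_frob_of_forall_EP ht hx⟩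

end TransportPolytope

/-- Identifiability from OT plans alone (converse part): if the representing extreme points
exhaust the optimal faces and the differences `π^(k) − u^(ℓ,k)` span a space of dimension less
than `(N−1)(M−1) − S`, then identifiability up to shift equivalence and the span of any `S`
matrices fails. -/
theorem stmt9 (N M K : ℕ) (hN : 1 ≤ N) (hM : 1 ≤ M)
    (μ : Fin K → Fin N → ℝ) (ν : Fin K → Fin M → ℝ)
    (hμ : ∀ k, μ k ∈ stdSimplex ℝ (Fin N)) (hν : ∀ k, ν k ∈ stdSimplex ℝ (Fin M))
    (hdist : Function.Injective (fun k => (μ k, ν k)))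
    (c : Matrix (Fin N) (Fin M) ℝ)
    (π : Fin K → Matrix (Fin N) (Fin M) ℝ) (hπ : ∀ k, π k ∈ OPT c (μ k) (ν k))
    (L : Fin K → ℕ) (u : (k : Fin K) → Fin (L k) → Matrix (Fin N) (Fin M) ℝ)
    (hu : ∀ k ℓ, u k ℓ ∈ EP (μ k) (ν k))
    (hrep : ∀ k, ∃ lam : Fin (L k) → ℝ,
      (∀ ℓ, 0 < lam ℓ) ∧ (∑ ℓ, lam ℓ = 1) ∧ π k = ∑ ℓ, lam ℓ • u k ℓ)
    (hconv : ∀ k, convexHull ℝ (Set.range (u k)) = OPT c (μ k) (ν k))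
    (S : ℕ)
    (hdim : Module.finrank ℝ
        (Submodule.span ℝ {d : Matrix (Fin N) (Fin M) ℝ | ∃ k ℓ, d = π k - u k ℓ}) + S <
      (N - 1) * (M - 1)) :
    ∀ w : Fin S → Matrix (Fin N) (Fin M) ℝ,
      ∃ c' : Matrix (Fin N) (Fin M) ℝ, (∀ k, π k ∈ OPT c' (μ k) (ν k)) ∧
        c' - c ∉ Submodule.span ℝ {x : Matrix (Fin N) (Fin M) ℝ | ∃ a b, x = oplus a b} ⊔
          Submodule.span ℝ (Set.range w) := by
  intro w
  set D := Submodule.span ℝ {d : Matrix (Fin N) (Fin M) ℝ | ∃ k ℓ, d = π k - u k ℓ}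
  set Z := Submodule.span ℝ {x : Matrix (Fin N) (Fin M) ℝ | ∃ a b, x = oplus a b} ⊔
    Submodule.span ℝ (Set.range w) with hZ
  have hZdim : Module.finrank ℝ Z < N + M + S := by
    have hsup := Submodule.finrank_add_le_finrank_add_finrank
      (Submodule.span ℝ {x : Matrix (Fin N) (Fin M) ℝ | ∃ a b, x = oplus a b})
      (Submodule.span ℝ (Set.range w))
    rw [← hZ] at hsup
    have hshift := finrank_span_oplus_lt (M := M) hN
    have hw := finrank_range_le_card (R := ℝ) w
    rw [Set.finrank, Fintype.card_fin] at hw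
    omega
  have hdimDZ : Module.finrank ℝ D + Module.finrank ℝ Z < N * M := by
    obtain ⟨n, rfl⟩ := Nat.exists_eq_add_of_le' hN
    obtain ⟨m, rfl⟩ := Nat.exists_eq_add_of_le' hM
    simp only [Nat.add_sub_cancel] at hdim
    nlinarith
  obtain ⟨h, hD, hnot⟩ := exists_frob_eq_zero_notMem D Z hdimDZ
  have hface (k : Fin K) : ∀ v ∈ OPT c (μ k) (ν k), frob h v = frob h (π k) := by
    rw [← hconv k]
    refine convexHull_min ?_ (convex_hyperplane (frobBilin h).isLinear (frob h (π k)))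
    rintro _ ⟨ℓ, rfl⟩
    have := hD _ (Submodule.subset_span ⟨k, ℓ, rfl⟩)
    rw [← frobBilin_apply, map_sub, sub_eq_zero] at this
    exact this.symm
  have hsmall : ∀ᶠ t in nhdsWithin (0 : ℝ) (Set.Ioi 0),
      ∀ k, π k ∈ OPT (c + t • h) (μ k) (ν k) :=
    Filter.eventually_all.2 fun k => eventually_mem_OPT (hπ k) (hface k)
  obtain ⟨t, ht, htpos⟩ := (hsmall.and self_mem_nhdsWithin).exists
  refine ⟨c + t • h, ht, ?_⟩
  rwa [add_sub_cancel_left, Submodule.smul_mem_iff _ (ne_of_gt htpos)]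
end
end

section
/- Suppose we observe K distinct pairs of marginals (μ^(k),ν^(k)) ∈ Δ_N × Δ_M, values α^(k) ∈ ℝ, plans π^(k) ∈ Π(μ^(k),ν^(k)), and extreme points u^(1,k),…,u^(L_k,k) ∈ EP(μ^(k),ν^(k)) representing π^(k). If the family {u^(ℓ,k) : ℓ ∈ {1,…,L_k}, k ∈ {1,…,K}}, viewed as vectors in ℝ^{NM}, contains NM linearly independent elements, then there is at most one matrix c' ∈ ℝ^{N×M} with ⟨c',π^(k)⟩ = OT_{c'}(μ^(k),ν^(k)) = α^(k) for all k, i.e., the cost matrix is identifiable in ℝ^{N×M}. -/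
open Finset

noncomputable section

/-- The Frobenius inner product with a fixed matrix, as a linear functional. -/
def frobLinear {N M : ℕ} (c : Matrix (Fin N) (Fin M) ℝ) : Matrix (Fin N) (Fin M) ℝ →ₗ[ℝ] ℝ where
  toFun := frob c
  map_add' x y := by
    simp only [frob, Matrix.add_apply, mul_add, sum_add_distrib]
  map_smul' a x := by
    simp only [frob, Matrix.smul_apply, smul_eq_mul, mul_sum, RingHom.id_apply]
    exact sum_congr rfl fun i _ => sum_congr rfl fun j _ => by ring

theorem frobLinear_apply {N M : ℕ} (c x : Matrix (Fin N) (Fin M) ℝ) :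
    frobLinear c x = frob c x := rfl

theorem frobLinear_injective {N M : ℕ} :
    Function.Injective (frobLinear : Matrix (Fin N) (Fin M) ℝ → _) := by
  intro c₁ c₂ h
  ext i j
  have hij := LinearMap.congr_fun h (Matrix.single i j 1)
  simpa [frobLinear_apply, frob, Matrix.single_apply, ite_and] using hij

theorem bddBelow_frob_image_Plans {N M : ℕ} (c : Matrix (Fin N) (Fin M) ℝ)
    (μ : Fin N → ℝ) (ν : Fin M → ℝ) : BddBelow (frob c '' Plans μ ν) := by
  refine ⟨∑ i, ∑ j, -(|c i j| * μ i), ?_⟩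
  rintro _ ⟨p, ⟨hp, hrow, -⟩, rfl⟩
  refine sum_le_sum fun i _ => sum_le_sum fun j _ => ?_
  have hle : p i j ≤ μ i := by
    rw [← hrow i]
    exact single_le_sum (f := fun j => p i j) (fun j _ => hp i j) (mem_univ j)
  calc -(|c i j| * μ i) ≤ -(|c i j| * p i j) := by gcongr
    _ = -|c i j| * p i j := by ring
    _ ≤ c i j * p i j := mul_le_mul_of_nonneg_right (neg_abs_le _) (hp i j)

theorem OTcost_le_frob {N M : ℕ} (c : Matrix (Fin N) (Fin M) ℝ) {μ : Fin N → ℝ}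
    {ν : Fin M → ℝ} {p : Matrix (Fin N) (Fin M) ℝ} (hp : p ∈ Plans μ ν) :
    OTcost c μ ν ≤ frob c p :=
  csInf_le (bddBelow_frob_image_Plans c μ ν) (Set.mem_image_of_mem _ hp)

/-- If a convex combination of plans with positive weights is optimal, so is each of the plans. -/
theorem frob_eq_OTcost_of_convex_combination {N M : ℕ} {ι : Type*} [Fintype ι]
    (c : Matrix (Fin N) (Fin M) ℝ) {μ : Fin N → ℝ} {ν : Fin M → ℝ}
    {u : ι → Matrix (Fin N) (Fin M) ℝ} (hu : ∀ l, u l ∈ Plans μ ν)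
    {w : ι → ℝ} (hw : ∀ l, 0 < w l) (hsum : ∑ l, w l = 1)
    (hopt : frob c (∑ l, w l • u l) = OTcost c μ ν) (l : ι) :
    frob c (u l) = OTcost c μ ν := by
  have hle : ∀ l ∈ univ, w l * OTcost c μ ν ≤ w l * frob c (u l) := fun l _ =>
    mul_le_mul_of_nonneg_left (OTcost_le_frob c (hu l)) (hw l).le
  have heq : ∑ l, w l * OTcost c μ ν = ∑ l, w l * frob c (u l) := by
    rw [← sum_mul, hsum, one_mul, ← hopt, ← frobLinear_apply, map_sum]
    simp only [map_smul, smul_eq_mul, frobLinear_apply]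
  exact (mul_left_cancel₀ (hw l).ne' ((sum_eq_sum_iff_of_le hle).1 heq l (mem_univ l))).symm

/-- If the representing extreme points contain `NM` linearly independent elements, then the cost
matrix is identifiable from total costs and OT plans. -/
theorem stmt11 (N M K : ℕ) (hN : 1 ≤ N) (hM : 1 ≤ M)
    (μ : Fin K → Fin N → ℝ) (ν : Fin K → Fin M → ℝ)
    (hμ : ∀ k, μ k ∈ stdSimplex ℝ (Fin N)) (hν : ∀ k, ν k ∈ stdSimplex ℝ (Fin M))
    (hdist : Function.Injective (fun k => (μ k, ν k)))
    (α : Fin K → ℝ)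
    (π : Fin K → Matrix (Fin N) (Fin M) ℝ) (hπ : ∀ k, π k ∈ Plans (μ k) (ν k))
    (L : Fin K → ℕ) (u : (k : Fin K) → Fin (L k) → Matrix (Fin N) (Fin M) ℝ)
    (hu : ∀ k ℓ, u k ℓ ∈ EP (μ k) (ν k))
    (hrep : ∀ k, ∃ lam : Fin (L k) → ℝ,
      (∀ ℓ, 0 < lam ℓ) ∧ (∑ ℓ, lam ℓ = 1) ∧ π k = ∑ ℓ, lam ℓ • u k ℓ)
    (hli : ∃ v : Fin (N * M) → Matrix (Fin N) (Fin M) ℝ,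
      (∀ r, ∃ k ℓ, v r = u k ℓ) ∧ LinearIndependent ℝ v) :
    ∀ c₁ c₂ : Matrix (Fin N) (Fin M) ℝ,
      (∀ k, frob c₁ (π k) = α k ∧ OTcost c₁ (μ k) (ν k) = α k) →
      (∀ k, frob c₂ (π k) = α k ∧ OTcost c₂ (μ k) (ν k) = α k) →
      c₁ = c₂ := by
  intro c₁ c₂ h₁ h₂
  obtain ⟨v, hv, hind⟩ := hli
  have hval : ∀ c : Matrix (Fin N) (Fin M) ℝ,
      (∀ k, frob c (π k) = α k ∧ OTcost c (μ k) (ν k) = α k) →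
      ∀ k l, frob c (u k l) = α k := by
    intro c hc k l
    obtain ⟨w, hw, hsum, hrepk⟩ := hrep k
    rw [← (hc k).2]
    refine frob_eq_OTcost_of_convex_combination c (fun l => (hu k l).1) hw hsum ?_ l
    rw [← hrepk, (hc k).1, (hc k).2]
  have hspan : Submodule.span ℝ (Set.range v) = ⊤ :=
    hind.span_eq_top_of_card_eq_finrank' (by simp [Module.finrank_matrix])
  refine frobLinear_injective (LinearMap.ext_on_range hspan fun r => ?_)
  obtain ⟨k, l, hr⟩ := hv r
  rw [hr, frobLinear_apply, frobLinear_apply, hval c₁ h₁, hval c₂ h₂]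
end
end
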